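/- arXiv:2505.00795 — 5 statements merged into one kernel-verified Lean document; each statement's English description precedes it below -/
import Mathlib

section
/- Let P be a nonzero polynomial with integer coefficients of degree n ≥ 1 such that P(1) ≠ 0. If τ is a real root of P with τ < 1, then τ ≤ 1 − 1/(n(n+1)·H(P)). -/
open Polynomial

/-- The height of an integer polynomial: the maximum of the absolute values of
its coefficients. -/
def polyHeight (P : Polynomial ℤ) : ℕ :=
  P.support.sup fun i => (P.coeff i).natAbs

/-- If `P` is a nonzero integer polynomial of degree `n ≥ 1` with `P(1) ≠ 0`,
then every real root `τ < 1` of `P` satisfies `τ ≤ 1 - 1/(n(n+1)·H(P))`. -/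
theorem root_lt_one_bound_of_eval_one_ne_zero (P : Polynomial ℤ) (hP : P ≠ 0)
    (n : ℕ) (hdeg : P.natDegree = n) (hn : 1 ≤ n) (h1 : P.eval 1 ≠ 0)
    (τ : ℝ) (hroot : Polynomial.aeval τ P = 0) (hτ : τ < 1) :
    τ ≤ 1 - 1 / (n * (n + 1) * (polyHeight P : ℝ)) := by
  have hH : ∀ i, |((P.coeff i : ℤ) : ℝ)| ≤ (polyHeight P : ℝ) := by
    intro i
    by_cases hi : i ∈ P.support
    · have h : (P.coeff i).natAbs ≤ polyHeight P :=
        Finset.le_sup (f := fun i => (P.coeff i).natAbs) hi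
      have h2 : (((P.coeff i).natAbs : ℕ) : ℝ) ≤ (polyHeight P : ℝ) := by exact_mod_cast h
      rwa [Nat.cast_natAbs, Int.cast_abs] at h2
    · rw [Polynomial.notMem_support_iff.mp hi]
      simp
  have hH1 : (1 : ℝ) ≤ (polyHeight P : ℝ) := by
    refine le_trans ?_ (hH P.natDegree)
    have : P.coeff P.natDegree ≠ 0 := by
      simpa using hP
    have := Int.one_le_abs this
    exact_mod_cast this
  have hn' : (1 : ℝ) ≤ n := by exact_mod_cast hn
  have hpos : (1 : ℝ) ≤ n * (n + 1) * (polyHeight P : ℝ) := by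
    have : (1 : ℝ) ≤ n * (n + 1) := by nlinarith
    nlinarith
  have key : 1 ≤ (1 - τ) * (n * (n + 1) * (polyHeight P : ℝ)) := by
    rcases le_or_gt τ 0 with h0 | h0
    · nlinarith
    have e1 : ((P.eval 1 : ℤ) : ℝ) = ∑ k ∈ Finset.range (n + 1), (P.coeff k : ℝ) := by
      rw [Polynomial.eval_eq_sum_range, hdeg]
      simp
    have e2 : (0 : ℝ) = ∑ k ∈ Finset.range (n + 1), (P.coeff k : ℝ) * τ ^ k := by
      rw [← hroot, Polynomial.aeval_eq_sum_range, hdeg]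
      simp
    have e3 : ((P.eval 1 : ℤ) : ℝ)
        = ∑ k ∈ Finset.range (n + 1), (P.coeff k : ℝ) * (1 - τ ^ k) := by
      rw [← sub_zero ((P.eval 1 : ℤ) : ℝ), e1, e2, ← Finset.sum_sub_distrib]
      exact Finset.sum_congr rfl fun k _ => by ring
    have e4 : (1 : ℝ) ≤ |((P.eval 1 : ℤ) : ℝ)| := by
      exact_mod_cast Int.one_le_abs h1
    refine e4.trans ?_
    rw [e3]
    refine (Finset.abs_sum_le_sum_abs _ _).trans ?_
    have hb : ∀ k ∈ Finset.range (n + 1),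
        |(P.coeff k : ℝ) * (1 - τ ^ k)| ≤ (polyHeight P : ℝ) * (n * (1 - τ)) := by
      intro k hk
      have hk' : (k : ℝ) ≤ n := by
        exact_mod_cast Nat.lt_succ_iff.mp (Finset.mem_range.mp hk)
      have hb1 : τ ^ k ≤ 1 := pow_le_one₀ h0.le hτ.le
      have hb2 : 1 + (k : ℝ) * (τ - 1) ≤ (1 + (τ - 1)) ^ k :=
        one_add_mul_le_pow (by linarith) k
      rw [add_sub_cancel] at hb2
      rw [abs_mul, abs_of_nonneg (sub_nonneg.mpr hb1)]
      refine mul_le_mul (hH k) ?_ (sub_nonneg.mpr hb1) (by linarith)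
      nlinarith
    refine (Finset.sum_le_sum hb).trans (le_of_eq ?_)
    simp only [Finset.sum_const, Finset.card_range, nsmul_eq_mul]
    push_cast
    ring
  have : 1 / (n * (n + 1) * (polyHeight P : ℝ)) ≤ 1 - τ := by
    rw [div_le_iff₀ (by linarith)]
    exact key
  linarith
end

section
/- Let n ≥ 1 and 1 ≤ z ≤ n. Let P be a polynomial with integer coefficients of degree at most n such that (x − 1)^z divides P, and let D be the polynomial with D(x)·(x − 1)^z = P(x). Then every coefficient d of D satisfies |d| ≤ binom(n, z) · H(P); that is, H(D) ≤ binom(n, z) · H(P). -/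
open Polynomial

theorem coeff_bound_aux (H : ℕ) (z : ℕ) : ∀ (D : Polynomial ℤ),
    (∀ j, ((D * (X - 1) ^ z).coeff j).natAbs ≤ H) →
    ∀ i, (D.coeff i).natAbs ≤ (i + z).choose z * H := by
  induction z with
  | zero =>
    intro D h i
    simpa using h i
  | succ z ih =>
    intro D h
    have hE := ih (D * (X - 1)) (by
      intro j
      have := h j
      rwa [pow_succ', ← mul_assoc] at this)
    intro i
    induction i with
    | zero =>
      have h0 := hE 0
      simp only [mul_sub, mul_one, coeff_sub, coeff_mul_X_zero, zero_add,
        Nat.choose_self, one_mul] at h0 ⊢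
      omega
    | succ i ihi =>
      have h1 := hE (i + 1)
      simp only [mul_sub, mul_one, coeff_sub, coeff_mul_X] at h1
      have e : (i + 1 + (z + 1)).choose (z + 1) * H
          = (i + 1 + z).choose z * H + (i + (z + 1)).choose (z + 1) * H := by
        rw [show i + 1 + (z + 1) = (i + 1 + z) + 1 by ring, Nat.choose_succ_succ,
          show i + (z + 1) = i + 1 + z by ring, Nat.succ_eq_add_one]
        ring
      rw [e]
      omega

theorem coeff_le_polyHeight_aux (P : Polynomial ℤ) (j : ℕ) :
    (P.coeff j).natAbs ≤ polyHeight P := by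
  by_cases h : P.coeff j = 0
  · simp [h]
  · exact Finset.le_sup (f := fun i => (P.coeff i).natAbs) (mem_support_iff.mpr h)

theorem natDegree_pow_X_sub_C_aux (z : ℕ) :
    ((X - 1 : Polynomial ℤ) ^ z).natDegree = z := by
  have h : (X - 1 : Polynomial ℤ) = X - C 1 := by simp
  rw [h, natDegree_pow, natDegree_X_sub_C, mul_one]

/-- If `P` is an integer polynomial of degree at most `n`, `1 ≤ z ≤ n`,
`(x-1)^z` divides `P`, and `D·(x-1)^z = P`, then every coefficient `d` of `D`
satisfies `|d| ≤ C(n,z)·H(P)`; that is, `H(D) ≤ C(n,z)·H(P)`. -/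
theorem height_of_quotient_by_pow_X_sub_one (n z : ℕ) (hz : 1 ≤ z) (hzn : z ≤ n)
    (P D : Polynomial ℤ) (hdeg : P.natDegree ≤ n)
    (hdvd : (X - 1) ^ z ∣ P) (hD : D * (X - 1) ^ z = P) :
    (∀ i, (D.coeff i).natAbs ≤ n.choose z * polyHeight P) ∧
      polyHeight D ≤ n.choose z * polyHeight P := by
  have key : ∀ i, (D.coeff i).natAbs ≤ n.choose z * polyHeight P := by
    intro i
    by_cases hi : D.coeff i = 0
    · simp [hi]
    have hb := coeff_bound_aux (polyHeight P) z D
      (by intro j; rw [hD]; exact coeff_le_polyHeight_aux P j) i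
    have hD0 : D ≠ 0 := by
      rintro rfl
      simp at hi
    have hm : ((X - 1 : Polynomial ℤ) ^ z).Monic := by
      have := (monic_X_sub_C (1 : ℤ)).pow z
      simpa using this
    have hn : ((X - 1 : Polynomial ℤ) ^ z).natDegree = z := natDegree_pow_X_sub_C_aux z
    have hdg : P.natDegree = D.natDegree + z := by
      rw [← hD, natDegree_mul hD0 hm.ne_zero, hn]
    have hile := le_natDegree_of_ne_zero hi
    exact hb.trans (Nat.mul_le_mul_right _ (Nat.choose_le_choose z (by omega)))
  exact ⟨key, Finset.sup_le fun i _ => key i⟩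
end

section
/- Let P be a nonzero polynomial with integer coefficients of degree n ≥ 1, and let z ≥ 0 be the multiplicity of 1 as a root of P (z = 0 if P(1) ≠ 0). If τ is a real root of P with τ < 1, then τ ≤ 1 − 1/(n(n+1)·binom(n, z)·H(P)). -/
open Polynomial

lemma coeff_step (R : Polynomial ℤ) (H : ℕ) (a : ℕ)
    (h : ∀ i, |((X - 1) * R).coeff i| ≤ H * ((i + a).choose a : ℤ)) (i : ℕ) :
    |R.coeff i| ≤ H * ((i + (a + 1)).choose (a + 1) : ℤ) := by
  induction i with
  | zero =>
    have := h 0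
    simp [sub_mul] at this ⊢
    exact this
  | succ i ih =>
    have h1 := h (i + 1)
    have e : ((X - 1) * R).coeff (i + 1) = R.coeff i - R.coeff (i + 1) := by
      simp [sub_mul]
    rw [e] at h1
    have p : (i + 1 + (a + 1)).choose (a + 1)
        = (i + 1 + a).choose a + (i + (a + 1)).choose (a + 1) := by
      rw [show i + 1 + (a + 1) = (i + 1 + a) + 1 by ring, Nat.choose_succ_succ,
        show i + (a + 1) = i + 1 + a by ring]
    rw [p]
    push_cast
    rw [mul_add]
    rw [abs_le] at *
    constructor <;> linarith [h1.1, h1.2, ih.1, ih.2]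

lemma coeff_bound (H : ℕ) (z : ℕ) : ∀ (Q : Polynomial ℤ),
    (∀ i, |((X - 1) ^ z * Q).coeff i| ≤ (H : ℤ)) →
    ∀ i, |Q.coeff i| ≤ H * ((i + z).choose z : ℤ) := by
  induction z with
  | zero => intro Q h i; simpa using h i
  | succ z ih =>
    intro Q h
    apply coeff_step
    apply ih
    intro i
    have := h i
    rwa [pow_succ, mul_assoc] at this

lemma coeff_le_height (P : Polynomial ℤ) (i : ℕ) : |P.coeff i| ≤ (polyHeight P : ℤ) := by
  by_cases hi : i ∈ P.support
  · have : (P.coeff i).natAbs ≤ polyHeight P :=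
      Finset.le_sup (f := fun i => (P.coeff i).natAbs) hi
    rw [Int.abs_eq_natAbs]
    exact_mod_cast this
  · rw [notMem_support_iff.mp hi]; simp

/-- If `P` is a nonzero integer polynomial of degree `n ≥ 1` and `z` is the
multiplicity of `1` as a root of `P` (`z = 0` when `P(1) ≠ 0`), then every
real root `τ < 1` of `P` satisfies `τ ≤ 1 - 1/(n(n+1)·C(n,z)·H(P))`. -/
theorem root_lt_one_bound (P : Polynomial ℤ) (hP : P ≠ 0)
    (n : ℕ) (hdeg : P.natDegree = n) (hn : 1 ≤ n)
    (z : ℕ) (hz : z = P.rootMultiplicity 1)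
    (τ : ℝ) (hroot : Polynomial.aeval τ P = 0) (hτ : τ < 1) :
    τ ≤ 1 - 1 / (n * (n + 1) * (n.choose z) * (polyHeight P : ℝ)) := by
  obtain ⟨Q, hQ, hnd⟩ := exists_eq_pow_rootMultiplicity_mul_and_not_dvd P hP 1
  rw [← hz] at hQ
  have hQ0 : Q ≠ 0 := by rintro rfl; simp at hnd
  have hQ1 : Q.eval 1 ≠ 0 := fun h => hnd (dvd_iff_isRoot.mpr h)
  have hmon : (X - C (1:ℤ)).Monic := monic_X_sub_C 1
  have hdQ : z + Q.natDegree = n := by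
    rw [← hdeg, hQ, (hmon.pow z).natDegree_mul' hQ0, hmon.natDegree_pow, natDegree_X_sub_C, mul_one]
  have hb : ∀ i, |Q.coeff i| ≤ polyHeight P * ((i + z).choose z : ℤ) := by
    apply coeff_bound
    intro i
    have := coeff_le_height P i
    have e : (X - 1) ^ z * Q = P := by rw [hQ]; simp
    rwa [e]
  have hQτ : aeval τ Q = 0 := by
    rw [hQ] at hroot
    simp only [map_mul, map_pow, map_sub, aeval_X, aeval_C] at hroot
    rcases mul_eq_zero.mp hroot with h | h
    · exfalso
      have h2 := eq_zero_of_pow_eq_zero h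
      simp at h2
      linarith
    · exact h
  have hH : 1 ≤ polyHeight P := by
    have h1 := coeff_le_height P P.natDegree
    have h2 : 0 < |P.coeff P.natDegree| := abs_pos.mpr (leadingCoeff_ne_zero.mpr hP)
    omega
  have hC : 1 ≤ n.choose z := Nat.choose_pos (by omega)
  have hHr : (1:ℝ) ≤ polyHeight P := by exact_mod_cast hH
  have hCr : (1:ℝ) ≤ n.choose z := by exact_mod_cast hC
  have hnr : (1:ℝ) ≤ n := by exact_mod_cast hn
  set D : ℝ := n * (n + 1) * (n.choose z) * (polyHeight P : ℝ) with hD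
  have hD1 : 1 ≤ D := by
    have a1 : (1:ℝ) ≤ n * (n + 1) := by nlinarith
    have a2 := one_le_mul_of_one_le_of_one_le a1 hCr
    exact one_le_mul_of_one_le_of_one_le a2 hHr
  have hDpos : 0 < D := by linarith
  rcases le_or_gt τ 0 with h0 | h0
  · have : 1 / D ≤ 1 := by rw [div_le_one hDpos]; exact hD1
    linarith
  suffices hk : 1 ≤ D * (1 - τ) by
    have : 1 / D ≤ 1 - τ := by rw [div_le_iff₀ hDpos]; linarith
    linarith
  have e1 : ((Q.eval 1 : ℤ) : ℝ)
      = ∑ i ∈ Finset.range (Q.natDegree + 1), (Q.coeff i : ℝ) * (1 - τ ^ i) := by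
    rw [aeval_eq_sum_range] at hQτ
    simp only [mul_sub, Finset.sum_sub_distrib, mul_one]
    rw [eval_eq_sum_range]
    simp only [zsmul_eq_mul] at hQτ
    rw [hQτ]
    simp
  have h1 : (1:ℝ) ≤ |((Q.eval 1 : ℤ) : ℝ)| := by
    exact_mod_cast Int.one_le_abs hQ1
  have h2 : ∀ i ∈ Finset.range (Q.natDegree + 1), |(Q.coeff i : ℝ) * (1 - τ ^ i)|
      ≤ (polyHeight P * n.choose z : ℝ) * (n * (1 - τ)) := by
    intro i hi
    have hi' : i + z ≤ n := by have := Finset.mem_range.mp hi; omega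
    rw [abs_mul]
    have c1 : |(Q.coeff i : ℝ)| ≤ polyHeight P * n.choose z := by
      have t1 : |(Q.coeff i : ℝ)| ≤ polyHeight P * ((i + z).choose z : ℝ) := by
        exact_mod_cast hb i
      have t2 : ((i + z).choose z : ℝ) ≤ n.choose z := by
        exact_mod_cast Nat.choose_le_choose z hi'
      exact t1.trans (by gcongr)
    have c2 : |1 - τ ^ i| ≤ n * (1 - τ) := by
      have b := one_add_mul_le_pow (a := τ - 1) (by linarith) i
      have b2 : τ ^ i ≤ 1 := pow_le_one₀ h0.le hτ.le
      have b3 : (i:ℝ) ≤ n := by exact_mod_cast (by omega : i ≤ n)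
      rw [abs_of_nonneg (by linarith)]
      have : 1 + (τ - 1) = τ := by ring
      rw [this] at b
      nlinarith
    exact mul_le_mul c1 c2 (abs_nonneg _) (by positivity)
  have h3 := (Finset.abs_sum_le_sum_abs _ _).trans (Finset.sum_le_sum h2)
  rw [← e1] at h3
  simp only [Finset.sum_const, Finset.card_range, nsmul_eq_mul] at h3
  have h4 : ((Q.natDegree + 1 : ℕ) : ℝ) ≤ n + 1 := by exact_mod_cast (by omega : Q.natDegree + 1 ≤ n + 1)
  have hτ' : 0 ≤ 1 - τ := by linarith
  calc (1:ℝ) ≤ _ := h1.trans h3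
    _ ≤ (n + 1) * ((polyHeight P * n.choose z : ℝ) * (n * (1 - τ))) := by gcongr
    _ = D * (1 - τ) := by rw [hD]; ring
end

section
/- Let P be a nonzero polynomial with integer coefficients of degree n ≥ 1 such that P(1) = 0, and let z ≥ 1 be the multiplicity of 1 as a root of P. If τ is a real root of P with τ < 1, then τ ≤ 1 − 1/(n(n+1)·(e·n/z)^z·H(P)), where e is Euler's number. -/
open Polynomial

theorem aux_step (R Q : Polynomial ℤ) (z H : ℕ) (hRQ : R = (X - 1) * Q)
    (hR : ∀ k, |R.coeff k| ≤ (H : ℤ) * ((k + z).choose z : ℕ)) :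
    ∀ k, |Q.coeff k| ≤ (H : ℤ) * ((k + (z + 1)).choose (z + 1) : ℕ) := by
  intro k
  induction k with
  | zero =>
    have h := hR 0
    have e : R.coeff 0 = - Q.coeff 0 := by
      rw [hRQ]; simp [sub_mul]
    rw [e, abs_neg] at h
    simpa using h
  | succ k ih =>
    have h := hR (k + 1)
    have e : R.coeff (k + 1) = Q.coeff k - Q.coeff (k + 1) := by
      rw [hRQ]; simp [sub_mul, coeff_X_mul]
    rw [e] at h
    have hc : (k + 1 + (z + 1)).choose (z + 1)
        = (k + 1 + z).choose z + (k + (z + 1)).choose (z + 1) := by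
      have := Nat.choose_succ_succ (k + 1 + z) z
      rw [show k + (z + 1) = k + 1 + z by ring]
      exact this
    rw [hc]
    push_cast
    have h2 : |Q.coeff (k + 1)| ≤ |Q.coeff k| + |Q.coeff k - Q.coeff (k + 1)| := by
      have := abs_sub (Q.coeff k) (Q.coeff k - Q.coeff (k + 1))
      simpa using this
    rw [mul_add]
    linarith

theorem aux_coeff (H : ℕ) (z : ℕ) : ∀ (P Q : Polynomial ℤ), P = (X - 1) ^ z * Q →
    (∀ k, |P.coeff k| ≤ (H : ℤ)) →
    ∀ k, |Q.coeff k| ≤ (H : ℤ) * ((k + z).choose z : ℕ) := by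
  induction z with
  | zero =>
    intro P Q h hP k
    have : P = Q := by simpa using h
    subst this
    simpa using hP k
  | succ z ih =>
    intro P Q h hP
    exact aux_step ((X - 1) * Q) Q z H rfl
      (ih P ((X - 1) * Q) (by rw [h, pow_succ, mul_assoc]) hP)

theorem aux_choose (n z : ℕ) (hz : 1 ≤ z) :
    ((n.choose z : ℕ) : ℝ) ≤ (Real.exp 1 * n / z) ^ z := by
  have h1 : ((n.choose z : ℕ) : ℝ) ≤ (n : ℝ) ^ z / (z.factorial : ℝ) := Nat.choose_le_pow_div z n
  have h2 : (z : ℝ) ^ z / (z.factorial : ℝ) ≤ Real.exp z :=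
    Real.pow_div_factorial_le_exp (z : ℝ) (by positivity) z
  have hz0 : (0 : ℝ) < z := by exact_mod_cast hz
  have h3 : (Real.exp 1) ^ z = Real.exp z := by
    rw [← Real.exp_nat_mul, mul_one]
  refine h1.trans ?_
  have e : (Real.exp 1 * n / z) ^ z = Real.exp z * ((n : ℝ) ^ z / (z : ℝ) ^ z) := by
    rw [div_pow, mul_pow, h3, mul_div_assoc]
  rw [e]
  have e2 : (n : ℝ) ^ z / (z.factorial : ℝ)
      = ((z : ℝ) ^ z / (z.factorial : ℝ)) * ((n : ℝ) ^ z / (z : ℝ) ^ z) := by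
    field_simp
  rw [e2]
  exact mul_le_mul_of_nonneg_right h2 (by positivity)

/-- If `P` is a nonzero integer polynomial of degree `n ≥ 1` with `P(1) = 0`
and `z ≥ 1` is the multiplicity of `1` as a root of `P`, then every real root
`τ < 1` of `P` satisfies `τ ≤ 1 - 1/(n(n+1)·(en/z)^z·H(P))`. -/
theorem root_lt_one_bound_exp (P : Polynomial ℤ) (hP : P ≠ 0)
    (n : ℕ) (hdeg : P.natDegree = n) (hn : 1 ≤ n)
    (h1 : P.eval 1 = 0)
    (z : ℕ) (hz : z = P.rootMultiplicity 1) (hz1 : 1 ≤ z)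
    (τ : ℝ) (hroot : Polynomial.aeval τ P = 0) (hτ : τ < 1) :
    τ ≤ 1 - 1 / (n * (n + 1) * (Real.exp 1 * n / z) ^ z * (polyHeight P : ℝ)) := by
  set H := polyHeight P with hH
  have hcoef : ∀ k, |P.coeff k| ≤ (H : ℤ) := by
    intro k
    by_cases hk : k ∈ P.support
    · have : (P.coeff k).natAbs ≤ H :=
        Finset.le_sup (f := fun i => (P.coeff i).natAbs) hk
      rw [Int.abs_eq_natAbs]
      exact_mod_cast this
    · rw [notMem_support_iff.mp hk]; simp
  have hH1 : 1 ≤ H := by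
    have h := hcoef P.natDegree
    have h0 : P.coeff P.natDegree ≠ 0 := by
      simpa using hP
    have := Int.one_le_abs h0
    exact_mod_cast this.trans h
  obtain ⟨Q, hQ, hnd⟩ := exists_eq_pow_rootMultiplicity_mul_and_not_dvd P hP 1
  rw [← hz] at hQ
  have hC1 : (C (1 : ℤ)) = 1 := C_1
  rw [hC1] at hQ hnd
  have hQ1 : Q.eval 1 ≠ 0 := by
    intro h
    apply hnd
    have := dvd_iff_isRoot.mpr h
    simpa using this
  have hQ0 : Q ≠ 0 := by
    rintro rfl
    simp at hQ1
  have hmon : ((X : Polynomial ℤ) - 1).Monic := by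
    have := monic_X_sub_C (1 : ℤ)
    simpa using this
  have hnat : z + Q.natDegree = n := by
    have hd : ((X : Polynomial ℤ) - 1).natDegree = 1 := by
      have := natDegree_X_sub_C (1 : ℤ)
      simpa using this
    rw [← hdeg, hQ, (hmon.pow z).natDegree_mul' hQ0, hmon.natDegree_pow, hd, mul_one]
  have hb := aux_coeff H z P Q hQ hcoef
  have hQτ : aeval τ Q = 0 := by
    rw [hQ] at hroot
    have h2 : (τ - 1) ^ z * aeval τ Q = 0 := by simpa using hroot
    rcases mul_eq_zero.mp h2 with h | h
    · exact absurd (pow_eq_zero_iff (by omega) |>.mp h) (by linarith)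
    · exact h
  have hch := aux_choose n z hz1
  set A := (Real.exp 1 * n / z) ^ z with hA
  have hchpos : (1 : ℝ) ≤ (n.choose z : ℕ) := by
    exact_mod_cast Nat.choose_pos (by omega)
  have hA1 : 1 ≤ A := hchpos.trans hch
  have hHR : (1 : ℝ) ≤ H := by exact_mod_cast hH1
  have hnR : (1 : ℝ) ≤ n := by exact_mod_cast hn
  have hn2 : (1 : ℝ) ≤ n * (n + 1) := by nlinarith
  have hD1 : 1 ≤ n * (n + 1) * A * (H : ℝ) :=
    one_le_mul_of_one_le_of_one_le (one_le_mul_of_one_le_of_one_le hn2 hA1) hHR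
  suffices h : 1 ≤ (1 - τ) * (n * (n + 1) * A * (H : ℝ)) by
    have : 1 / (n * (n + 1) * A * (H : ℝ)) ≤ 1 - τ := by
      rw [div_le_iff₀ (by linarith)]; exact h
    linarith
  by_cases hτ0 : τ ≤ 0
  · exact one_le_mul_of_one_le_of_one_le (by linarith) hD1
  push Not at hτ0
  have hs1 : ((Q.eval 1 : ℤ) : ℝ) = ∑ k ∈ Finset.range (Q.natDegree + 1), (Q.coeff k : ℝ) := by
    rw [eval_eq_sum_range]; simp
  have hsτ : (0 : ℝ) = ∑ k ∈ Finset.range (Q.natDegree + 1), (Q.coeff k : ℝ) * τ ^ k := by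
    rw [← hQτ, aeval_eq_sum_range]; simp
  have hdiff : ((Q.eval 1 : ℤ) : ℝ)
      = ∑ k ∈ Finset.range (Q.natDegree + 1), (Q.coeff k : ℝ) * (1 - τ ^ k) := by
    simp only [mul_sub, mul_one, Finset.sum_sub_distrib]
    rw [← hs1, ← hsτ, sub_zero]
  have h1le : (1 : ℝ) ≤ |((Q.eval 1 : ℤ) : ℝ)| := by
    exact_mod_cast Int.one_le_abs hQ1
  have hterm : ∀ k ∈ Finset.range (Q.natDegree + 1),
      |(Q.coeff k : ℝ) * (1 - τ ^ k)| ≤ (H * A) * (n * (1 - τ)) := by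
    intro k hk
    have hk' : k ≤ Q.natDegree := by
      have := Finset.mem_range.mp hk
      omega
    rw [abs_mul]
    have hq : |(Q.coeff k : ℝ)| ≤ H * A := by
      have h2 : |(Q.coeff k : ℝ)| ≤ (H : ℝ) * ((k + z).choose z : ℕ) := by
        exact_mod_cast hb k
      have h3 : (((k + z).choose z : ℕ) : ℝ) ≤ (n.choose z : ℕ) := by
        exact_mod_cast Nat.choose_le_choose z (by omega)
      exact h2.trans (mul_le_mul_of_nonneg_left (h3.trans hch) (by linarith))
    have hp : |1 - τ ^ k| ≤ n * (1 - τ) := by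
      have h4 : τ ^ k ≤ 1 := pow_le_one₀ hτ0.le hτ.le
      rw [abs_of_nonneg (by linarith)]
      have h5 := one_add_mul_le_pow (a := τ - 1) (by linarith) k
      have h6 : (k : ℝ) ≤ n := by exact_mod_cast (by omega : k ≤ n)
      have h7 : (k : ℝ) * (1 - τ) ≤ n * (1 - τ) :=
        mul_le_mul_of_nonneg_right h6 (by linarith)
      rw [add_sub_cancel] at h5
      linarith
    exact mul_le_mul hq hp (abs_nonneg _) (by positivity)
  have hsum : |((Q.eval 1 : ℤ) : ℝ)| ≤ (Q.natDegree + 1 : ℝ) * ((H * A) * (n * (1 - τ))) := by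
    rw [hdiff]
    refine (Finset.abs_sum_le_sum_abs _ _).trans ((Finset.sum_le_sum hterm).trans ?_)
    simp
  have hm : (Q.natDegree + 1 : ℝ) ≤ n + 1 := by
    exact_mod_cast (by omega : Q.natDegree + 1 ≤ n + 1)
  have hpos : 0 ≤ (H * A) * (n * (1 - τ)) :=
    mul_nonneg (by positivity) (mul_nonneg (by positivity) (by linarith))
  have := mul_le_mul_of_nonneg_right hm hpos
  calc (1 : ℝ) ≤ (n + 1) * ((H * A) * (n * (1 - τ))) := by linarith
    _ = _ := by ring
end

section
/- There exists an absolute constant c > 0 such that for every nonzero polynomial P with integer coefficients of degree n ≥ 1, the multiplicity z of 1 as a root of P satisfies z ≤ c·(n·(1 + log H(P)))^{1/2}. -/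
open Polynomial

/-- Moments of the coefficients vanish below the order of vanishing at `1`. -/
lemma moment_zero (j : ℕ) : ∀ (P : ℝ[X]) (N : ℕ), P.natDegree < N →
    (X - C 1) ^ (j + 1) ∣ P → ∑ k ∈ Finset.range N, P.coeff k * (k : ℝ) ^ j = 0 := by
  induction j with
  | zero =>
    intro P N hN h
    have h1 : P.eval 1 = 0 := by
      obtain ⟨q, rfl⟩ := h
      simp
    rw [eval_eq_sum_range' hN] at h1
    simpa using h1
  | succ j ih =>
    intro P N hN h
    have h1 := pow_sub_one_dvd_derivative_of_pow_dvd h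
    have h2 := ih (X * derivative P) N ?_ (Dvd.dvd.mul_left (by simpa using h1) X)
    · rw [← h2]
      apply Finset.sum_congr rfl
      intro k _
      cases k with
      | zero => simp
      | succ k =>
        rw [coeff_X_mul, coeff_derivative]
        push_cast
        ring
    · by_cases h0 : P.natDegree = 0
      · have : derivative P = 0 := by
          rw [natDegree_eq_zero] at h0
          obtain ⟨a, rfl⟩ := h0
          simp
        rw [this]
        simp
        omega
      · have := natDegree_derivative_lt h0
        have h3 := natDegree_mul_le (p := (X : ℝ[X])) (q := derivative P)
        rw [natDegree_X] at h3
        omega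

lemma sum_eval_zero (z N : ℕ) (P R : ℝ[X]) (hN : P.natDegree < N)
    (h : (X - C 1) ^ z ∣ P) (hR : R.natDegree < z) :
    ∑ k ∈ Finset.range N, P.coeff k * R.eval (k : ℝ) = 0 := by
  simp_rw [eval_eq_sum_range' hR, Finset.mul_sum]
  rw [Finset.sum_comm]
  apply Finset.sum_eq_zero
  intro j hj
  have := moment_zero j P N hN ((pow_dvd_pow _ (Finset.mem_range.mp hj)).trans h)
  calc _ = R.coeff j * ∑ k ∈ Finset.range N, P.coeff k * (k : ℝ) ^ j := by
        rw [Finset.mul_sum]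
        exact Finset.sum_congr rfl fun _ _ => by ring
    _ = 0 := by rw [this, mul_zero]

/-- Fejér type polynomial. -/
lemma exists_fejer (n M : ℕ) (hn : 1 ≤ n) (hM : 1 ≤ M) :
    ∃ A : ℝ[X], A.natDegree + 1 ≤ M ∧ A.eval 0 = 1 ∧
      ∀ x : ℝ, 0 < x → x ≤ n → |A.eval x| ≤ (n / (M : ℝ) ^ 2) / x := by
  have hn' : (0 : ℝ) < n := by exact_mod_cast hn
  have hM' : (0 : ℝ) < M := by exact_mod_cast hM
  set F : ℝ[X] := 1 - (Chebyshev.T ℝ (M : ℤ)).comp (1 - C (2 / (n : ℝ)) * X) with hF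
  have hF0 : F.eval 0 = 0 := by simp [hF]
  obtain ⟨G, hG⟩ : X ∣ F := by
    rw [X_dvd_iff, coeff_zero_eq_eval_zero, hF0]
  have hd : (derivative F).eval 0 = 2 / n * (M : ℝ) ^ 2 := by
    simp [hF, derivative_comp, Chebyshev.derivative_T_eval_one]
  have hG0 : G.eval 0 = 2 / n * (M : ℝ) ^ 2 := by
    rw [← hd, hG]
    simp
  have hFd : F.natDegree ≤ M := by
    rw [hF]
    refine (natDegree_sub_le _ _).trans ?_
    rw [natDegree_one, natDegree_comp]
    have h1 : (Chebyshev.T ℝ (M : ℤ)).natDegree = M := by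
      simp
    have h2 : (1 - C (2 / (n : ℝ)) * X).natDegree ≤ 1 := by
      compute_degree
    rw [h1]
    simpa using Nat.mul_le_mul_left M h2
  have hc : 2 / n * (M : ℝ) ^ 2 ≠ 0 := by positivity
  have hGne : G ≠ 0 := by
    rintro rfl
    simp at hG0
    rcases hG0 with h | h
    · exact absurd h (by omega)
    · exact absurd h (by omega)
  refine ⟨C (2 / n * (M : ℝ) ^ 2)⁻¹ * G, ?_, ?_, ?_⟩
  · have h1 : F.natDegree = G.natDegree + 1 := by
      rw [hG, natDegree_X_mul hGne]
    have h2 := natDegree_C_mul_le (2 / n * (M : ℝ) ^ 2)⁻¹ G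
    omega
  · rw [eval_mul, eval_C, hG0, inv_mul_cancel₀ hc]
  · intro x hx hxn
    have h1 : F.eval x = x * G.eval x := by rw [hG]; simp
    have h2 : |F.eval x| ≤ 2 := by
      have h3 : |1 - 2 / (n : ℝ) * x| ≤ 1 := by
        have h4 : x / n ≤ 1 := (div_le_one hn').mpr hxn
        have h5 : 0 ≤ x / n := by positivity
        have h6 : 2 / (n : ℝ) * x = 2 * (x / n) := by ring
        rw [h6, abs_le]
        constructor <;> linarith
      have h4 := Chebyshev.abs_eval_T_real_le_one (M : ℤ) h3
      have h5 : F.eval x = 1 - (Chebyshev.T ℝ (M : ℤ)).eval (1 - 2 / (n : ℝ) * x) := by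
        simp [hF]
      rw [h5]
      rw [abs_le] at h4 ⊢
      constructor <;> linarith [h4.1, h4.2]
    rw [h1, abs_mul, abs_of_pos hx] at h2
    rw [eval_mul, eval_C, abs_mul, abs_of_pos (by positivity)]
    have h3 : |G.eval x| ≤ 2 / x := by
      rw [le_div_iff₀ hx]; linarith
    calc _ ≤ (2 / n * (M : ℝ) ^ 2)⁻¹ * (2 / x) := by gcongr
      _ = _ := by field_simp

/-- Polynomial vanishing at `1, …, K`. -/
lemma exists_kill (K : ℕ) :
    ∃ W : ℝ[X], W.natDegree ≤ K ∧ W.eval 0 = 1 ∧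
      ∀ x : ℕ, 1 ≤ x → |W.eval (x : ℝ)| ≤ (x : ℝ) ^ K / (K.factorial : ℝ) := by
  refine ⟨∏ k ∈ Finset.range K, (1 - C (1 / ((k : ℝ) + 1)) * X), ?_, ?_, ?_⟩
  · refine (natDegree_prod_le _ _).trans ?_
    calc _ ≤ ∑ k ∈ Finset.range K, 1 := by
          apply Finset.sum_le_sum
          intro k _
          compute_degree
      _ = K := by simp
  · simp [eval_prod]
  · intro x hx
    rw [eval_prod]
    by_cases hxK : x ≤ K
    · have : ∏ k ∈ Finset.range K, eval (x : ℝ) (1 - C (1 / ((k : ℝ) + 1)) * X) = 0 := by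
        apply Finset.prod_eq_zero (i := x - 1) (Finset.mem_range.mpr (by omega))
        have h1 : (((x - 1 : ℕ) : ℝ)) + 1 = x := by
          exact_mod_cast (by omega : x - 1 + 1 = x)
        have h2 : (x : ℝ) ≠ 0 := by
          exact_mod_cast (by omega : x ≠ 0)
        rw [h1]
        simp [h2]
      rw [this, abs_zero]
      positivity
    · rw [Finset.abs_prod, ← Finset.prod_range_add_one_eq_factorial]
      have : (x : ℝ) ^ K = ∏ k ∈ Finset.range K, (x : ℝ) := by simp
      rw [this, Nat.cast_prod, ← Finset.prod_div_distrib]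
      apply Finset.prod_le_prod
      · intros; positivity
      · intro k hk
        have hk' := Finset.mem_range.mp hk
        have h1 : 1 ≤ (x : ℝ) / (k + 1) := by
          rw [le_div_iff₀ (by positivity)]
          exact_mod_cast (by omega : 1 * (k + 1) ≤ x)
        have h2 : eval (x : ℝ) (1 - C (1 / ((k : ℝ) + 1)) * X) = 1 - x / (k + 1) := by
          simp
          ring
        rw [h2, abs_of_nonpos (by linarith)]
        push_cast
        linarith

lemma sum_inv_sq_aux (n : ℕ) :
    ∑ k ∈ Finset.range (n + 1), 1 / ((k : ℝ) + 1) ^ 2 ≤ (2 - 1 / (n + 1) : ℝ) := by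
  induction n with
  | zero => norm_num
  | succ n ih =>
    rw [Finset.sum_range_succ]
    push_cast
    have : 1 / ((n : ℝ) + 1 + 1) ^ 2 ≤ 1 / (n + 1) - 1 / ((n : ℝ) + 1 + 1) := by
      rw [div_sub_div _ _ (by positivity) (by positivity),
        div_le_div_iff₀ (by positivity) (by positivity)]
      nlinarith [Nat.cast_nonneg (α := ℝ) n]
    linarith

lemma sum_inv_sq (n : ℕ) : ∑ k ∈ Finset.range n, 1 / ((k : ℝ) + 1) ^ 2 ≤ 2 := by
  have h := sum_inv_sq_aux n
  rw [Finset.sum_range_succ] at h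
  have h1 : 0 ≤ 1 / ((n : ℝ) + 1) ^ 2 := by positivity
  have h2 : 0 ≤ 1 / ((n : ℝ) + 1) := by positivity
  linarith

lemma numeric (K : ℕ) (L H : ℝ) (hL : 0 ≤ L) (hLK : L ≤ K / 25) (hH : 0 ≤ H)
    (hHK : H ≤ Real.exp K) : H * (2 * (L ^ (K + 2) / K.factorial)) < 1 := by
  have h1 : (K : ℝ) ^ K / K.factorial ≤ Real.exp K :=
    Real.pow_div_factorial_le_exp _ (by positivity) _
  have h2 : (K : ℝ) ^ 2 ≤ 2 * Real.exp K := by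
    have := Real.pow_div_factorial_le_exp (K : ℝ) (by positivity) 2
    norm_num at this
    linarith
  have h3 : Real.exp K * Real.exp K * Real.exp K ≤ 25 ^ K := by
    have h4 : Real.exp 1 * Real.exp 1 * Real.exp 1 ≤ 25 := by
      have := Real.exp_one_lt_d9
      have h0 := Real.exp_pos 1
      have h5 : Real.exp 1 ≤ 2.72 := by linarith
      calc _ ≤ (2.72 : ℝ) * 2.72 * 2.72 := by gcongr
        _ ≤ 25 := by norm_num
    have h5 : Real.exp K = Real.exp 1 ^ K := by rw [← Real.exp_nat_mul]; simp
    rw [h5, ← mul_pow, ← mul_pow]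
    exact pow_le_pow_left₀ (by positivity) h4 K
  have hE := Real.exp_pos (K : ℝ)
  set E := Real.exp (K : ℝ)
  calc H * (2 * (L ^ (K + 2) / K.factorial))
      ≤ E * (2 * (((K : ℝ) / 25) ^ (K + 2) / K.factorial)) := by gcongr
    _ = E * (2 * ((K : ℝ) ^ K / K.factorial) * (K : ℝ) ^ 2 / 625) / 25 ^ K := by
        rw [div_pow, pow_add, pow_add]; field_simp; norm_num
    _ ≤ E * (2 * E * (2 * E) / 625) / 25 ^ K := by gcongr
    _ = 4 / 625 * (E * E * E / 25 ^ K) := by ring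
    _ ≤ 4 / 625 * 1 := by
        gcongr
        exact (div_le_one (by positivity)).mpr h3
    _ < 1 := by norm_num

/-- Main combinatorial bound. -/
lemma main_bound (P : ℤ[X]) (hP : P ≠ 0) (hn : 1 ≤ P.natDegree) (K M : ℕ) (hM : 1 ≤ M)
    (hHK : (polyHeight P : ℝ) ≤ Real.exp K)
    (hL : (P.natDegree : ℝ) / (M : ℝ) ^ 2 ≤ K / 25) :
    P.rootMultiplicity 1 ≤ K + (K + 2) * (M - 1) := by
  by_contra hcon
  push Not at hcon
  set n := P.natDegree with hndef
  set L := (n : ℝ) / (M : ℝ) ^ 2 with hLdef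
  have hL0 : 0 ≤ L := by positivity
  obtain ⟨A, hAd, hA0, hA⟩ := exists_fejer n M hn hM
  obtain ⟨W, hWd, hW0, hW⟩ := exists_kill K
  set Q := W * A ^ (K + 2) with hQ
  have hQd : Q.natDegree ≤ K + (K + 2) * (M - 1) := by
    refine natDegree_mul_le.trans (add_le_add hWd (natDegree_pow_le.trans ?_))
    exact Nat.mul_le_mul_left _ (by omega)
  have hQ0 : Q.eval 0 = 1 := by simp [hQ, hW0, hA0]
  set B := L ^ (K + 2) / (K.factorial : ℝ) with hB
  have hB0 : 0 ≤ B := by positivity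
  have hQx : ∀ x : ℕ, 1 ≤ x → x ≤ n → |Q.eval (x : ℝ)| ≤ B * (1 / (x : ℝ) ^ 2) := by
    intro x hx hxn
    have hx' : (0 : ℝ) < x := by exact_mod_cast hx
    rw [hQ, eval_mul, eval_pow, abs_mul, abs_pow]
    calc _ ≤ ((x : ℝ) ^ K / (K.factorial : ℝ)) * (L / x) ^ (K + 2) := by
          gcongr
          · exact hW x hx
          · exact hA x hx' (by exact_mod_cast hxn)
      _ = _ := by
          rw [hB, div_pow, pow_add (x : ℝ)]
          field_simp
  set PR : ℝ[X] := P.map (Int.castRingHom ℝ) with hPR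
  have hdvd : (X - C 1) ^ (P.rootMultiplicity 1) ∣ PR := by
    have := Polynomial.map_dvd (Int.castRingHom ℝ) (P.pow_rootMultiplicity_dvd 1)
    simpa using this
  have hR : (Q.comp (C (n : ℝ) - X)).natDegree < P.rootMultiplicity 1 := by
    refine lt_of_le_of_lt ?_ hcon
    rw [natDegree_comp]
    have h2 : (C (n : ℝ) - X).natDegree ≤ 1 := by
      compute_degree
    calc _ ≤ Q.natDegree * 1 := Nat.mul_le_mul_left _ h2
      _ ≤ _ := by simpa using hQd
  have hPd : PR.natDegree < n + 1 := by
    exact Nat.lt_succ_of_le (natDegree_map_le (f := Int.castRingHom ℝ) (p := P))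
  have hsum := sum_eval_zero _ (n + 1) PR _ hPd hdvd hR
  rw [Finset.sum_range_succ] at hsum
  simp only [eval_comp, eval_sub, eval_C, eval_X, sub_self, hQ0, mul_one] at hsum
  have hcoef : ∀ k, |PR.coeff k| ≤ (polyHeight P : ℝ) := by
    intro k
    rw [hPR, coeff_map]
    have h1 : (P.coeff k).natAbs ≤ polyHeight P := by
      by_cases hk : k ∈ P.support
      · exact Finset.le_sup (f := fun i => (P.coeff i).natAbs) hk
      · simp [notMem_support_iff.mp hk]
    have h2 : |((P.coeff k : ℤ) : ℝ)| = ((P.coeff k).natAbs : ℝ) := by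
      rw [Nat.cast_natAbs, Int.cast_abs]
    rw [eq_intCast, h2]
    exact_mod_cast h1
  have hlead : 1 ≤ |PR.coeff n| := by
    rw [hPR, coeff_map, eq_intCast, ← Int.cast_abs]
    have : P.coeff n ≠ 0 := by
      rw [hndef]; simpa using hP
    exact_mod_cast Int.one_le_abs this
  have hbound : |PR.coeff n| ≤ (polyHeight P : ℝ) * (2 * B) := by
    have h1 : PR.coeff n = -∑ k ∈ Finset.range n, PR.coeff k * Q.eval ((n : ℝ) - k) := by
      linarith
    rw [h1, abs_neg]
    calc _ ≤ ∑ k ∈ Finset.range n, |PR.coeff k * Q.eval ((n : ℝ) - k)| :=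
          Finset.abs_sum_le_sum_abs _ _
      _ ≤ ∑ k ∈ Finset.range n, (polyHeight P : ℝ) *
            (B * (1 / (((n - 1 - k : ℕ) : ℝ) + 1) ^ 2)) := by
          apply Finset.sum_le_sum
          intro k hk
          have hk' := Finset.mem_range.mp hk
          have h2 : (n : ℝ) - k = ((n - k : ℕ) : ℝ) := by
            rw [Nat.cast_sub hk'.le]
          have h3 : ((n - 1 - k : ℕ) : ℝ) + 1 = ((n - k : ℕ) : ℝ) := by
            exact_mod_cast (by omega : n - 1 - k + 1 = n - k)
          rw [abs_mul, h2, h3]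
          gcongr
          · exact hcoef k
          · exact hQx _ (by omega) (by omega)
      _ = (polyHeight P : ℝ) * ((∑ k ∈ Finset.range n, 1 / ((k : ℝ) + 1) ^ 2) * B) := by
          rw [← Finset.sum_range_reflect (fun k : ℕ => 1 / ((k : ℝ) + 1) ^ 2), Finset.sum_mul,
            Finset.mul_sum]
          exact Finset.sum_congr rfl fun _ _ => by ring
      _ ≤ _ := by
          gcongr
          exact sum_inv_sq n
  have := numeric K L (polyHeight P) hL0 hL (by positivity) hHK
  linarith

/-- There is an absolute constant `c > 0` such that for every nonzero integer
polynomial `P` of degree `n ≥ 1`, the multiplicity `z` of `1` as a root of `P`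
satisfies `z ≤ c·(n(1 + log H(P)))^{1/2}`. -/
theorem rootMultiplicity_one_bound :
    ∃ c : ℝ, 0 < c ∧
      ∀ P : Polynomial ℤ, P ≠ 0 → 1 ≤ P.natDegree →
        ((P.rootMultiplicity 1 : ℝ) ≤
          c * ((P.natDegree : ℝ) * (1 + Real.log (polyHeight P))) ^ ((1 : ℝ) / 2)) := by
  refine ⟨32, by norm_num, fun P hP hn => ?_⟩
  rw [← Real.sqrt_eq_rpow]
  have hn' : (1 : ℝ) ≤ P.natDegree := by exact_mod_cast hn
  have hH : 1 ≤ polyHeight P := by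
    have h1 : (P.coeff P.natDegree).natAbs ≤ polyHeight P :=
      Finset.le_sup (f := fun i => (P.coeff i).natAbs) (natDegree_mem_support_of_nonzero hP)
    have h2 : P.coeff P.natDegree ≠ 0 := by simpa using hP
    have := Int.natAbs_pos.mpr h2
    omega
  have hH' : (1 : ℝ) ≤ polyHeight P := by exact_mod_cast hH
  have hlog := Real.log_nonneg hH'
  set K := ⌈Real.log (polyHeight P)⌉₊ + 1 with hK
  have hK1 : (1 : ℝ) ≤ K := by rw [hK]; push_cast; linarith [Nat.cast_nonneg (α := ℝ) ⌈Real.log (polyHeight P)⌉₊]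
  have hKlog : Real.log (polyHeight P) ≤ K := by
    rw [hK]; push_cast; linarith [Nat.le_ceil (Real.log (polyHeight P))]
  have hK2 : (K : ℝ) ≤ 2 * (1 + Real.log (polyHeight P)) := by
    rw [hK]; push_cast; linarith [Nat.ceil_lt_add_one hlog]
  have hHK : (polyHeight P : ℝ) ≤ Real.exp K :=
    (Real.log_le_iff_le_exp (by linarith)).mp hKlog
  set n := P.natDegree with hndef
  set z := P.rootMultiplicity 1 with hz
  have hkey : (z : ℝ) ≤ 16 * √(n * K) := by
    by_cases hKn : n < K
    · have h1 : z ≤ n := by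
        have h2 := natDegree_le_of_dvd (P.pow_rootMultiplicity_dvd 1) hP
        have h3 : ((X - C (1 : ℤ)) ^ rootMultiplicity 1 P).natDegree = rootMultiplicity 1 P := by
          rw [natDegree_pow, natDegree_X_sub_C, mul_one]
        omega
      have h2 : (n : ℝ) ≤ √(n * K) := by
        apply Real.le_sqrt_of_sq_le
        have : (n : ℝ) ≤ K := by exact_mod_cast hKn.le
        nlinarith
      have h3 : (z : ℝ) ≤ n := by exact_mod_cast h1
      linarith [Real.sqrt_nonneg ((n : ℝ) * K)]
    · push Not at hKn
      have hKn' : (K : ℝ) ≤ n := by exact_mod_cast hKn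
      set t := 5 * √((n : ℝ) / K) with ht
      have ht0 : 0 < t := by positivity
      set M := ⌈t⌉₊ with hMdef
      have hM1 : 1 ≤ M := Nat.one_le_ceil_iff.mpr ht0
      have hMt : t ≤ M := Nat.le_ceil t
      have hMt' : (M : ℝ) < t + 1 := Nat.ceil_lt_add_one ht0.le
      have hL : (n : ℝ) / (M : ℝ) ^ 2 ≤ K / 25 := by
        have h1 : t ^ 2 ≤ (M : ℝ) ^ 2 := by gcongr
        have h2 : t ^ 2 = 25 * (n / K) := by
          rw [ht, mul_pow, Real.sq_sqrt (by positivity)]; norm_num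
        have hM0 : (0 : ℝ) < M := by exact_mod_cast hM1
        rw [div_le_div_iff₀ (by positivity) (by norm_num)]
        calc (n : ℝ) * 25 = K * (25 * (n / K)) := by field_simp
          _ ≤ K * (M : ℝ) ^ 2 := by rw [← h2]; gcongr
      have hb := main_bound P hP hn K M hM1 hHK hL
      have hb' : (z : ℝ) ≤ K + (K + 2) * (M - 1) := by
        have : (z : ℝ) ≤ ((K + (K + 2) * (M - 1) : ℕ) : ℝ) := by exact_mod_cast hb
        rw [Nat.cast_add, Nat.cast_mul, Nat.cast_sub hM1] at this
        simpa using this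
      have h1 : (K : ℝ) ≤ √(n * K) := by
        apply Real.le_sqrt_of_sq_le
        nlinarith
      have h2 : K * √((n : ℝ) / K) = √(n * K) := by
        rw [eq_comm, Real.sqrt_eq_iff_mul_self_eq (by positivity) (by positivity)]
        have := Real.mul_self_sqrt (by positivity : 0 ≤ (n : ℝ) / K)
        symm
        calc _ = (K : ℝ) * K * (√((n : ℝ) / K) * √((n : ℝ) / K)) := by ring
          _ = _ := by rw [this]; field_simp
      calc (z : ℝ) ≤ K + (K + 2) * (M - 1) := hb'
        _ ≤ K + (3 * K) * t := by
          gcongr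
          · have : (1 : ℝ) ≤ M := by exact_mod_cast hM1
            linarith
          · linarith
          · linarith
        _ = K + 15 * (K * √((n : ℝ) / K)) := by rw [ht]; ring
        _ ≤ _ := by rw [h2]; linarith
  have h1 : √((n : ℝ) * K) ≤ 2 * √(n * (1 + Real.log (polyHeight P))) := by
    have h2 : (2 : ℝ) = √4 := by
      rw [show (4 : ℝ) = 2 ^ 2 by norm_num, Real.sqrt_sq (by norm_num)]
    rw [h2, ← Real.sqrt_mul (by norm_num)]
    apply Real.sqrt_le_sqrt
    nlinarith
  linarith
end
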